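/- arXiv:2205.14967 — 2 statements merged into one kernel-verified Lean document; each statement's English description precedes it below -/
import Mathlib

section
/- (Contraction of a tree edge preserves the remaining cover and cut values.) Let T be a spanning tree of a finite weighted graph G and let g ∈ E(T). Let G/g and T/g denote the multigraphs obtained by contracting g (identifying its two endpoints and deleting the resulting self-loops), with all other edge weights unchanged. Then T/g is a spanning tree of G/g and, for all tree edges e, f ∈ E(T) \ {g}: Cov_{T/g, G/g}(e, f) = Cov_{T,G}(e, f), Cut_{T/g, G/g}(e, f) = Cut_{T,G}(e, f), and Cut_{T/g, G/g}(e) = Cut_{T,G}(e). -/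
open Finset

variable {V : Type*}

/-- The graph edge `g` covers the tree edge `e`: every `T`-path between the
endpoints of `g` contains `e` (in a tree this path is unique). -/
def EdgeCoversIn (T : SimpleGraph V) (g e : Sym2 V) : Prop :=
  ∀ u v : V, g = s(u, v) → ∀ p : T.Walk u v, p.IsPath → e ∈ p.edges

open scoped Classical in
/-- Cover value `Cov_{T,G}(e,f)`: total weight of edges of `G` covering both `e` and `f`. -/
noncomputable def covVal [Fintype V] (G T : SimpleGraph V) (w : Sym2 V → ℝ)
    (e f : Sym2 V) : ℝ :=
  ∑ g : Sym2 V,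
    if g ∈ G.edgeSet ∧ EdgeCoversIn T g e ∧ EdgeCoversIn T g f then w g else 0

open scoped Classical in
/-- Cut value `Cut_{T,G}(e,f)`: total weight of edges of `G` covering exactly one of `e`, `f`. -/
noncomputable def cutVal [Fintype V] (G T : SimpleGraph V) (w : Sym2 V → ℝ)
    (e f : Sym2 V) : ℝ :=
  ∑ g : Sym2 V,
    if g ∈ G.edgeSet ∧ Xor' (EdgeCoversIn T g e) (EdgeCoversIn T g f) then w g else 0

open scoped Classical in
/-- 1-respecting cut value `Cut_{T,G}(e)`: total weight of edges of `G` covering `e`. -/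
noncomputable def cutVal1 [Fintype V] (G T : SimpleGraph V) (w : Sym2 V → ℝ)
    (e : Sym2 V) : ℝ :=
  ∑ g : Sym2 V, if g ∈ G.edgeSet ∧ EdgeCoversIn T g e then w g else 0

theorem covers_iff_aux {W : Type*} (T : SimpleGraph W) (u v : W) (e : Sym2 W) :
    EdgeCoversIn T s(u, v) e ↔ ¬ (T.deleteEdges {e}).Reachable u v := by
  classical
  constructor
  · rintro h ⟨p⟩
    have h1 := h u v rfl (p.toPath.1.mapLe (T.deleteEdges_le {e}))
      ((SimpleGraph.Walk.isPath_mapLe _).2 p.toPath.2)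
    rw [SimpleGraph.Walk.edges_mapLe_eq_edges] at h1
    have h2 := SimpleGraph.Walk.edges_subset_edgeSet _ h1
    rw [SimpleGraph.edgeSet_deleteEdges] at h2
    exact h2.2 rfl
  · intro h a b hab p hp
    by_contra hne
    have hr : (T.deleteEdges {e}).Reachable a b := ⟨p.toDeleteEdge e hne⟩
    rcases Sym2.eq_iff.1 hab with ⟨rfl, rfl⟩ | ⟨rfl, rfl⟩
    · exact h hr
    · exact h hr.symm

theorem triangle_aux {W : Type*} (T : SimpleGraph W) (hT : T.IsAcyclic) {x y z : W}
    (h1 : T.Adj x y) (h2 : T.Adj y z) (h3 : T.Adj x z) : False := by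
  have hb := (SimpleGraph.isAcyclic_iff_forall_adj_isBridge.1 hT) h2
  rw [SimpleGraph.isBridge_iff] at hb
  apply hb
  have a1 : (T.deleteEdges {s(y,z)}).Adj y x := by
    rw [SimpleGraph.deleteEdges_adj]
    refine ⟨h1.symm, ?_⟩
    have := h1.ne; have := h2.ne; have := h3.ne
    simp only [Set.mem_singleton_iff, Sym2.eq_iff]
    grind
  have a2 : (T.deleteEdges {s(y,z)}).Adj x z := by
    rw [SimpleGraph.deleteEdges_adj]
    refine ⟨h3, ?_⟩
    have := h1.ne; have := h2.ne; have := h3.ne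
    simp only [Set.mem_singleton_iff, Sym2.eq_iff]
    grind
  exact a1.reachable.trans a2.reachable

open scoped Classical in
theorem inj_aux {W : Type*} (T : SimpleGraph W) (hT : T.IsAcyclic) (x0 y0 : W)
    (hg : T.Adj x0 y0) (q : W → {z : W // z ≠ y0})
    (hq : ∀ z : W, (q z : W) = if z = y0 then x0 else z)
    (a b c d : W) (h1 : T.Adj a b) (h2 : T.Adj c d)
    (hn1 : s(a, b) ≠ s(x0, y0)) (hn2 : s(c, d) ≠ s(x0, y0))
    (h : s(q a, q b) = s(q c, q d)) : s(a, b) = s(c, d) := by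
  have tri : ∀ z, T.Adj y0 z → T.Adj x0 z → False := fun z => triangle_aux T hT hg
  have hab := h1.ne
  have hcd := h2.ne
  have hxy := hg.ne
  have h1s := h1.symm
  have h2s := h2.symm
  simp only [ne_eq, Sym2.eq_iff, Subtype.ext_iff, hq] at h hn1 hn2 ⊢
  grind

open scoped Classical in
theorem reach_aux {W : Type*} (T : SimpleGraph W) (hT : T.IsAcyclic) (x0 y0 : W)
    (hg : T.Adj x0 y0) (q : W → {z : W // z ≠ y0})
    (hq : ∀ z : W, (q z : W) = if z = y0 then x0 else z)
    (T' : SimpleGraph {z : W // z ≠ y0})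
    (hT' : ∀ a b : {z : W // z ≠ y0},
      T'.Adj a b ↔ a ≠ b ∧ ∃ te ∈ T.edgeSet, Sym2.map q te = s(a, b))
    (e : Sym2 W) (he : e ∈ T.edgeSet) (hne : e ≠ s(x0, y0)) (u v : W) :
    (T.deleteEdges {e}).Reachable u v ↔
      (T'.deleteEdges {Sym2.map q e}).Reachable (q u) (q v) := by
  have hz : ∀ z, (T.deleteEdges {e}).Reachable z (q z : W) := by
    intro z
    rw [hq]
    split_ifs with h
    · subst h
      apply SimpleGraph.Adj.reachable
      rw [SimpleGraph.deleteEdges_adj]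
      refine ⟨hg.symm, ?_⟩
      rw [Set.mem_singleton_iff, Sym2.eq_swap]
      exact fun h => hne h.symm
    · exact SimpleGraph.Reachable.refl _
  constructor
  · rintro ⟨p⟩
    induction p with
    | nil => exact SimpleGraph.Reachable.refl _
    | @cons a b c hab p ih =>
      refine SimpleGraph.Reachable.trans ?_ ih
      by_cases hqq : q a = q b
      · rw [hqq]
      · apply SimpleGraph.Adj.reachable
        rw [SimpleGraph.deleteEdges_adj] at hab ⊢
        refine ⟨(hT' _ _).2 ⟨hqq, s(a, b), hab.1, rfl⟩, ?_⟩
        intro hm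
        apply hab.2
        induction e using Sym2.ind with
        | _ c d =>
        refine inj_aux T hT x0 y0 hg q hq a b c d hab.1 he ?_ hne hm
        intro hx
        apply hqq
        apply Subtype.ext
        rw [hq, hq]
        rcases Sym2.eq_iff.1 hx with ⟨rfl, rfl⟩ | ⟨rfl, rfl⟩ <;> simp
  · have key : ∀ a b, (T'.deleteEdges {Sym2.map q e}).Reachable a b →
        (T.deleteEdges {e}).Reachable (a : W) (b : W) := by
      rintro a b ⟨p⟩
      induction p with
      | nil => exact SimpleGraph.Reachable.refl _
      | @cons a b c hab p ih =>
        refine SimpleGraph.Reachable.trans ?_ ih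
        rw [SimpleGraph.deleteEdges_adj] at hab
        obtain ⟨hadj, hnm⟩ := hab
        obtain ⟨-, te, hte, hm⟩ := (hT' _ _).1 hadj
        induction te using Sym2.ind with
        | _ c d =>
        have hcd : (T.deleteEdges {e}).Adj c d := by
          rw [SimpleGraph.deleteEdges_adj]
          refine ⟨hte, ?_⟩
          intro h
          rw [Set.mem_singleton_iff] at h
          apply hnm
          rw [← hm, h]; rfl
        have hr := (hz c).symm.trans (hcd.reachable.trans (hz d))
        rw [Sym2.map_mk] at hm
        rcases Sym2.eq_iff.1 hm with ⟨h1, h2⟩ | ⟨h1, h2⟩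
        · rw [h1, h2] at hr; exact hr
        · rw [h1, h2] at hr; exact hr.symm
    intro h
    exact (hz u).trans ((key _ _ h).trans (hz v).symm)

open scoped Classical in
theorem sum_aux {A B : Type*} [Fintype A] [Fintype B] (m : A → B) (G : A → Prop) (P : A → Prop)
    (Q : B → Prop) (w : A → ℝ) (w' : B → ℝ)
    {i1 : ∀ a b, Decidable (G a ∧ m a = b)} {i2 : ∀ b, Decidable (Q b)}
    {i3 : ∀ a, Decidable (G a ∧ P a)}
    (hw' : ∀ b, w' b = ∑ a, if G a ∧ m a = b then w a else 0)
    (h : ∀ a, G a → (Q (m a) ↔ P a)) :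
    (∑ b, if Q b then w' b else 0) = ∑ a, if G a ∧ P a then w a else 0 := by
  have : ∀ b, (if Q b then w' b else 0) = ∑ a, if m a = b then (if G a ∧ Q (m a) then w a else 0) else 0 := by
    intro b
    rw [hw']
    split_ifs with hb
    · apply Finset.sum_congr rfl
      intro a _
      by_cases hab : m a = b
      · subst hab; simp [hb]
      · simp [hab]
    · symm
      apply Finset.sum_eq_zero
      intro a _
      by_cases hab : m a = b
      · subst hab; simp [hb]
      · simp [hab]
  rw [Finset.sum_congr rfl (fun b _ => this b), Finset.sum_comm]
  apply Finset.sum_congr rfl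
  intro a _
  rw [Finset.sum_ite_eq]
  simp only [Finset.mem_univ, if_true]
  by_cases ha : G a
  · simp only [ha, true_and, h a ha]
  · simp [ha]

open scoped Classical in
/-- Contraction of a tree edge preserves the remaining cover and cut values.
The tree edge `g = s(x0, y0)` of the spanning tree `T` of `G` is contracted by the map
`q` identifying `y0` with `x0` (self-loops deleted, since images `s(a,b)` require
`a ≠ b`); parallel edges created by the contraction are summed in `w'`.  `G'` and `T'`
are the contracted graphs `G/g` and `T/g` on the vertex set `{z // z ≠ y0}`.  Then `T/g`
is a spanning tree of `G/g`, and all cover/cut values of the remaining tree edges are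
preserved. -/
theorem stmt7 [Fintype V] (G T : SimpleGraph V) (w : Sym2 V → ℝ)
    (hw : ∀ g ∈ G.edgeSet, 0 < w g)
    (hle : T ≤ G) (hT : T.IsTree)
    (x0 y0 : V) (hg : s(x0, y0) ∈ T.edgeSet)
    (q : V → {z : V // z ≠ y0})
    (hq : ∀ z : V, (q z : V) = if z = y0 then x0 else z)
    (G' T' : SimpleGraph {z : V // z ≠ y0})
    (hG' : ∀ a b : {z : V // z ≠ y0},
      G'.Adj a b ↔ a ≠ b ∧ ∃ ge ∈ G.edgeSet, Sym2.map q ge = s(a, b))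
    (hT' : ∀ a b : {z : V // z ≠ y0},
      T'.Adj a b ↔ a ≠ b ∧ ∃ te ∈ T.edgeSet, Sym2.map q te = s(a, b))
    (w' : Sym2 {z : V // z ≠ y0} → ℝ)
    (hw' : ∀ e' : Sym2 {z : V // z ≠ y0},
      w' e' = ∑ ge : Sym2 V, if ge ∈ G.edgeSet ∧ Sym2.map q ge = e' then w ge else 0) :
    T' ≤ G' ∧ T'.IsTree ∧
    ∀ e f : Sym2 V, e ∈ T.edgeSet → f ∈ T.edgeSet →
      e ≠ s(x0, y0) → f ≠ s(x0, y0) →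
      covVal G' T' w' (Sym2.map q e) (Sym2.map q f) = covVal G T w e f ∧
      cutVal G' T' w' (Sym2.map q e) (Sym2.map q f) = cutVal G T w e f ∧
      cutVal1 G' T' w' (Sym2.map q e) = cutVal1 G T w e := by
  have hadj : T.Adj x0 y0 := hg
  have hac := hT.isAcyclic
  have hsub : T' ≤ G' := by
    intro a b h
    obtain ⟨h1, te, hte, h2⟩ := (hT' a b).1 h
    exact (hG' a b).2 ⟨h1, te, SimpleGraph.edgeSet_mono hle hte, h2⟩
  have hqs : ∀ a : {z : V // z ≠ y0}, q a = a := by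
    intro a
    apply Subtype.ext
    rw [hq, if_neg a.2]
  have hreach := reach_aux T hac x0 y0 hadj q hq T' hT'
  have hcov : ∀ ge e : Sym2 V, e ∈ T.edgeSet → e ≠ s(x0, y0) →
      (EdgeCoversIn T' (Sym2.map q ge) (Sym2.map q e) ↔ EdgeCoversIn T ge e) := by
    intro ge e he hne
    induction ge using Sym2.ind with
    | _ u v =>
    rw [Sym2.map_mk, covers_iff_aux, covers_iff_aux, hreach e he hne]
  have hloop : ∀ ge e : Sym2 V, ge ∈ G.edgeSet →
      EdgeCoversIn T' (Sym2.map q ge) (Sym2.map q e) → Sym2.map q ge ∈ G'.edgeSet := by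
    intro ge e hge hc
    induction ge using Sym2.ind with
    | _ u v =>
    rw [Sym2.map_mk, covers_iff_aux] at hc
    refine (hG' _ _).2 ⟨?_, s(u, v), hge, rfl⟩
    intro h
    apply hc
    have h' : q u = q v := h
    rw [h']
  refine ⟨hsub, ⟨?_, ?_⟩, ?_⟩
  · have hne : Nonempty {z : V // z ≠ y0} := ⟨q x0⟩
    refine SimpleGraph.Connected.mk ?_
    intro a b
    have : ∀ u v : V, T.Reachable u v → T'.Reachable (q u) (q v) := by
      rintro u v ⟨p⟩
      induction p with
      | nil => exact SimpleGraph.Reachable.refl _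
      | @cons a b c hab p ih =>
        refine SimpleGraph.Reachable.trans ?_ ih
        by_cases hqq : q a = q b
        · rw [hqq]
        · exact ((hT' _ _).2 ⟨hqq, s(a, b), hab, rfl⟩).reachable
    have h := this a b (hT.connected.preconnected _ _)
    rwa [hqs, hqs] at h
  · rw [SimpleGraph.isAcyclic_iff_forall_adj_isBridge]
    intro a b hab
    obtain ⟨hne, te, hte, hm⟩ := (hT' a b).1 hab
    have hteg : te ≠ s(x0, y0) := by
      rintro rfl
      have : q x0 = q y0 := by
        apply Subtype.ext
        rw [hq, hq]; simp
      rw [Sym2.map_mk, this] at hm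
      rcases Sym2.eq_iff.1 hm with ⟨h1, h2⟩ | ⟨h1, h2⟩
      · exact hne (h1.symm.trans h2)
      · exact hne (h2.symm.trans h1)
    rw [SimpleGraph.isBridge_iff]
    intro hr
    have hr2 : (T'.deleteEdges {Sym2.map q te}).Reachable a b := by rw [hm]; exact hr
    induction te using Sym2.ind with
    | _ c d =>
    have hb := SimpleGraph.isAcyclic_iff_forall_adj_isBridge.1 hac (show T.Adj c d from hte)
    rw [SimpleGraph.isBridge_iff] at hb
    apply hb
    refine (hreach s(c, d) hte hteg c d).2 ?_
    rw [Sym2.map_mk] at hm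
    rcases Sym2.eq_iff.1 hm with ⟨h1, h2⟩ | ⟨h1, h2⟩
    · rw [h1, h2]; exact hr2
    · rw [h1, h2]; exact hr2.symm
  · intro e f he hf hne hnf
    refine ⟨?_, ?_, ?_⟩
    · unfold covVal
      refine sum_aux (Sym2.map q) (· ∈ G.edgeSet)
        (fun g => EdgeCoversIn T g e ∧ EdgeCoversIn T g f) _ w w' hw' ?_
      intro ge hge
      have := hcov ge e he hne
      have := hcov ge f hf hnf
      have := hloop ge e hge
      tauto
    · unfold cutVal
      refine sum_aux (Sym2.map q) (· ∈ G.edgeSet)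
        (fun g => Xor' (EdgeCoversIn T g e) (EdgeCoversIn T g f)) _ w w' hw' ?_
      intro ge hge
      have h1 := hcov ge e he hne
      have h2 := hcov ge f hf hnf
      have h3 := hloop ge e hge
      have h4 := hloop ge f hge
      simp only [Xor', Xor]
      tauto
    · unfold cutVal1
      refine sum_aux (Sym2.map q) (· ∈ G.edgeSet)
        (fun g => EdgeCoversIn T g e) _ w w' hw' ?_
      intro ge hge
      have := hcov ge e he hne
      have := hloop ge e hge
      tauto
end

section
/- Let (G, T) be a star instance with paths P_1, …, P_k, where all edge weights of G are positive integers with total weight W := Σ_{g ∈ E(G)} w(g). Then each path P_i is weakly interested in at most 10·(2 + log_{1.1} W) other paths; that is, the number of indices j ≠ i for which some edge e ∈ E(P_i) and some edge f ∈ E(P_j) satisfy CrossCov(e, f) > CrossCov(e)/5 is at most 10·(2 + log_{1.1} W). -/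
open Finset

variable {V : Type*}

/-- The `t`-th edge (in order of increasing depth, `t = 0` being the attachment edge at
the root) of the `i`-th descending path of a star instance whose `i`-th path has vertex
chain `v i 0 = r, v i 1, …, v i (ℓ i)`. -/
def PathEdge {k : ℕ} (ℓ : Fin k → ℕ) (v : (i : Fin k) → Fin (ℓ i + 1) → V)
    (i : Fin k) (t : Fin (ℓ i)) : Sym2 V :=
  s(v i t.castSucc, v i t.succ)

/-- `g` is a cross-edge of the star instance: its two endpoints lie on two different
paths (the root `r = v i 0` does not lie on any path). -/
def IsCrossEdge {k : ℕ} (ℓ : Fin k → ℕ) (v : (i : Fin k) → Fin (ℓ i + 1) → V)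
    (g : Sym2 V) : Prop :=
  ∃ (i j : Fin k) (x : Fin (ℓ i + 1)) (y : Fin (ℓ j + 1)),
    i ≠ j ∧ (x : ℕ) ≠ 0 ∧ (y : ℕ) ≠ 0 ∧ g = s(v i x, v j y)

open scoped Classical in
/-- `CrossCov(e, f)`: total weight of the cross-edges covering both `e` and `f`. -/
noncomputable def crossCov2 [Fintype V] (G T : SimpleGraph V) (w : Sym2 V → ℝ)
    {k : ℕ} (ℓ : Fin k → ℕ) (v : (i : Fin k) → Fin (ℓ i + 1) → V)
    (e f : Sym2 V) : ℝ :=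
  ∑ g : Sym2 V,
    if g ∈ G.edgeSet ∧ IsCrossEdge ℓ v g ∧ EdgeCoversIn T g e ∧ EdgeCoversIn T g f
    then w g else 0

open scoped Classical in
/-- `CrossCov(e)`: total weight of the cross-edges covering `e`. -/
noncomputable def crossCov1 [Fintype V] (G T : SimpleGraph V) (w : Sym2 V → ℝ)
    {k : ℕ} (ℓ : Fin k → ℕ) (v : (i : Fin k) → Fin (ℓ i + 1) → V)
    (e : Sym2 V) : ℝ :=
  ∑ g : Sym2 V,
    if g ∈ G.edgeSet ∧ IsCrossEdge ℓ v g ∧ EdgeCoversIn T g e then w g else 0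

theorem aux_idx {r : V} {k : ℕ} {ℓ : Fin k → ℕ} {v : (i : Fin k) → Fin (ℓ i + 1) → V}
    (hv0 : ∀ i, v i 0 = r) (hvinj : ∀ i, Function.Injective (v i))
    (hdisj : ∀ i j x y, i ≠ j → v i x = v j y → v i x = r)
    {a b : Fin k} {x : Fin (ℓ a + 1)} {y : Fin (ℓ b + 1)} (hx : (x : ℕ) ≠ 0)
    (h : v a x = v b y) : a = b := by
  by_contra hab
  have h1 := hdisj a b x y hab h
  rw [← hv0 a] at h1
  have h2 := hvinj a h1
  rw [h2] at hx
  simp at hx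

theorem aux_walk {T : SimpleGraph V} {r : V} {k : ℕ} {ℓ : Fin k → ℕ}
    {v : (i : Fin k) → Fin (ℓ i + 1) → V}
    (hv0 : ∀ i, v i 0 = r)
    (hAdj : ∀ x y : V, T.Adj x y ↔
      ∃ (i : Fin k) (t : Fin (ℓ i)), s(x, y) = PathEdge ℓ v i t)
    (a : Fin k) (n : ℕ) (hn : n < ℓ a + 1) :
    ∃ p : T.Walk (v a ⟨n, hn⟩) r, ∀ e ∈ p.edges, ∃ s : Fin (ℓ a), (s : ℕ) < n ∧
      e = PathEdge ℓ v a s := by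
  induction n with
  | zero =>
    have : v a ⟨0, hn⟩ = r := hv0 a
    rw [this]
    exact ⟨SimpleGraph.Walk.nil, by simp⟩
  | succ n ih =>
    obtain ⟨p, hp⟩ := ih (by omega)
    have hE : s(v a ⟨n + 1, hn⟩, v a ⟨n, by omega⟩) = PathEdge ℓ v a ⟨n, by omega⟩ := by
      rw [Sym2.eq_swap]; rfl
    refine ⟨SimpleGraph.Walk.cons ((hAdj _ _).2 ⟨a, ⟨n, by omega⟩, hE⟩) p, ?_⟩
    intro e he
    rw [SimpleGraph.Walk.edges_cons, List.mem_cons] at he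
    rcases he with rfl | he
    · exact ⟨⟨n, by omega⟩, by simp, hE⟩
    · obtain ⟨s, hs, h⟩ := hp e he
      exact ⟨s, by omega, h⟩

theorem aux_edge {r : V} {k : ℕ} {ℓ : Fin k → ℕ} {v : (i : Fin k) → Fin (ℓ i + 1) → V}
    (hv0 : ∀ i, v i 0 = r) (hvinj : ∀ i, Function.Injective (v i))
    (hdisj : ∀ i j x y, i ≠ j → v i x = v j y → v i x = r)
    {j a : Fin k} {t : Fin (ℓ j)} {s : Fin (ℓ a)} {n : ℕ} (hs : (s : ℕ) < n)
    (h : PathEdge ℓ v j t = PathEdge ℓ v a s) : j = a ∧ (t : ℕ) < n := by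
  have hm : v j t.succ ∈ PathEdge ℓ v a s := by
    rw [← h]; exact Sym2.mem_mk_right _ _
  rw [PathEdge, Sym2.mem_iff] at hm
  have ht : ((t.succ : Fin (ℓ j + 1)) : ℕ) ≠ 0 := by simp
  have hja : j = a := by
    rcases hm with hm | hm <;> exact aux_idx hv0 hvinj hdisj ht hm
  subst hja
  refine ⟨rfl, ?_⟩
  rcases hm with hm | hm
  · have := congrArg Fin.val (hvinj j hm)
    simp at this; omega
  · have := congrArg Fin.val (hvinj j hm)
    simp at this; omega

/-- `g` joins path `j` below edge `t` with a nonroot vertex of path `b`. -/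
def Joins {k : ℕ} (ℓ : Fin k → ℕ) (v : (i : Fin k) → Fin (ℓ i + 1) → V)
    (j : Fin k) (t : ℕ) (b : Fin k) (g : Sym2 V) : Prop :=
  ∃ (x : Fin (ℓ j + 1)) (y : Fin (ℓ b + 1)), t < (x : ℕ) ∧ (y : ℕ) ≠ 0 ∧ g = s(v j x, v b y)

theorem aux_cov {T : SimpleGraph V} {r : V} {k : ℕ} {ℓ : Fin k → ℕ}
    {v : (i : Fin k) → Fin (ℓ i + 1) → V}
    (hv0 : ∀ i, v i 0 = r) (hvinj : ∀ i, Function.Injective (v i))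
    (hdisj : ∀ i j x y, i ≠ j → v i x = v j y → v i x = r)
    (hAdj : ∀ x y : V, T.Adj x y ↔
      ∃ (i : Fin k) (t : Fin (ℓ i)), s(x, y) = PathEdge ℓ v i t)
    (j : Fin k) (t : Fin (ℓ j)) (g : Sym2 V) (hg : IsCrossEdge ℓ v g)
    (hc : EdgeCoversIn T g (PathEdge ℓ v j t)) : ∃ b, b ≠ j ∧ Joins ℓ v j t b g := by
  classical
  obtain ⟨a, b, x, y, hab, hx, hy, rfl⟩ := hg
  obtain ⟨p, hp⟩ := aux_walk hv0 hAdj a x x.2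
  obtain ⟨q, hq⟩ := aux_walk hv0 hAdj b y y.2
  have h1 := hc _ _ rfl (p.append q.reverse).bypass (SimpleGraph.Walk.bypass_isPath _)
  have h2 := SimpleGraph.Walk.edges_bypass_subset_edges _ h1
  rw [SimpleGraph.Walk.edges_append, List.mem_append, SimpleGraph.Walk.edges_reverse,
    List.mem_reverse] at h2
  rcases h2 with h2 | h2
  · obtain ⟨s, hs, h⟩ := hp _ h2
    obtain ⟨rfl, h3⟩ := aux_edge hv0 hvinj hdisj hs h
    exact ⟨b, hab.symm, x, y, h3, hy, rfl⟩
  · obtain ⟨s, hs, h⟩ := hq _ h2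
    obtain ⟨rfl, h3⟩ := aux_edge hv0 hvinj hdisj hs h
    exact ⟨a, hab, y, x, h3, hx, Sym2.eq_swap⟩

theorem aux_joins {T : SimpleGraph V} {r : V} {k : ℕ} {ℓ : Fin k → ℕ}
    {v : (i : Fin k) → Fin (ℓ i + 1) → V}
    (hv0 : ∀ i, v i 0 = r) (hvinj : ∀ i, Function.Injective (v i))
    (hdisj : ∀ i j x y, i ≠ j → v i x = v j y → v i x = r)
    (hAdj : ∀ x y : V, T.Adj x y ↔
      ∃ (i : Fin k) (t : Fin (ℓ i)), s(x, y) = PathEdge ℓ v i t)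
    (j : Fin k) (t : Fin (ℓ j)) (g : Sym2 V) (b : Fin k) (hb : b ≠ j)
    (hJ : Joins ℓ v j t b g) : IsCrossEdge ℓ v g ∧ EdgeCoversIn T g (PathEdge ℓ v j t) := by
  obtain ⟨x, y, hx, hy, rfl⟩ := hJ
  refine ⟨⟨j, b, x, y, hb.symm, by omega, hy, rfl⟩, ?_⟩
  -- key fact for walks in the canonical direction
  have key : ∀ p : T.Walk (v j x) (v b y), PathEdge ℓ v j t ∈ p.edges := by
    intro p
    obtain ⟨d, hd, h1, h2⟩ := p.exists_boundary_dart {u | ∃ z : Fin (ℓ j + 1), (t : ℕ) < z ∧ u = v j z}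
      ⟨x, hx, rfl⟩ (by
        rintro ⟨z, hz, h⟩
        exact hb (aux_idx hv0 hvinj hdisj (by omega) h.symm).symm)
    have hmem : d.edge ∈ p.edges := List.mem_map_of_mem hd
    obtain ⟨z, hz, hzd⟩ := h1
    obtain ⟨a, s, hs⟩ := (hAdj _ _).1 d.adj
    have hde : d.edge = PathEdge ℓ v a s := by
      rw [← hs]; rfl
    have hzm : v j z ∈ PathEdge ℓ v a s := by
      rw [← hs, ← hzd]; exact Sym2.mem_mk_left _ _
    have hja : j = a := by
      rw [PathEdge, Sym2.mem_iff] at hzm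
      rcases hzm with hm | hm <;> exact aux_idx hv0 hvinj hdisj (by omega) hm
    subst hja
    rw [PathEdge, Sym2.eq_iff] at hs
    have hst : s = t := by
      rcases hs with ⟨h3, h4⟩ | ⟨h3, h4⟩
      · exfalso
        apply h2
        refine ⟨s.succ, ?_, h4⟩
        have := congrArg Fin.val (hvinj j (hzd.symm.trans h3))
        simp at this
        simp; omega
      · have h5 := congrArg Fin.val (hvinj j (hzd.symm.trans h3))
        have h6 : ¬ ((t : ℕ) < (s.castSucc : Fin (ℓ j + 1))) := fun h => h2 ⟨_, h, h4⟩
        simp at h5 h6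
        apply Fin.ext
        have h7 : (s : ℕ) ≤ t := by exact_mod_cast h6
        omega
    rw [← hst, ← hde]; exact hmem
  intro u u' h p _
  rw [Sym2.eq_iff] at h
  rcases h with ⟨rfl, rfl⟩ | ⟨rfl, rfl⟩
  · exact key p
  · have := key p.reverse
    rwa [SimpleGraph.Walk.edges_reverse, List.mem_reverse] at this

theorem aux_uniq {r : V} {k : ℕ} {ℓ : Fin k → ℕ} {v : (i : Fin k) → Fin (ℓ i + 1) → V}
    (hv0 : ∀ i, v i 0 = r) (hvinj : ∀ i, Function.Injective (v i))
    (hdisj : ∀ i j x y, i ≠ j → v i x = v j y → v i x = r)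
    {i b j c : Fin k} {t t' : ℕ} {g : Sym2 V} (h1 : Joins ℓ v i t b g)
    (h2 : Joins ℓ v j t' c g) : (i = j ∧ b = c) ∨ (i = c ∧ b = j) := by
  obtain ⟨x, y, hx, hy, rfl⟩ := h1
  obtain ⟨x', y', hx', hy', h⟩ := h2
  rw [Sym2.eq_iff] at h
  rcases h with ⟨h, h'⟩ | ⟨h, h'⟩
  · exact Or.inl ⟨aux_idx hv0 hvinj hdisj (by omega) h, aux_idx hv0 hvinj hdisj hy h'⟩
  · exact Or.inr ⟨aux_idx hv0 hvinj hdisj (by omega) h, aux_idx hv0 hvinj hdisj hy h'⟩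

theorem aux_count {α : Type*} [DecidableEq α] (J : Finset α) {n : ℕ} (t : α → Fin n)
    (A : Fin n → ℝ) (B : Fin n → α → ℝ) (W : ℝ)
    (hAW : ∀ s, A s ≤ W) (hA1 : ∀ j ∈ J, 1 ≤ A (t j))
    (hB : ∀ j ∈ J, A (t j) / 5 < B (t j) j)
    (hB0 : ∀ s j, 0 ≤ B s j)
    (hmono : ∀ j s s', s ≤ s' → B s' j ≤ B s j)
    (hsum : ∀ s, ∑ j ∈ J, B s j ≤ A s) (hne : J.Nonempty) :
    (J.card : ℝ) ≤ 10 * (2 + Real.logb 1.1 W) := by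
  have hlog0 : ∀ j ∈ J, 0 ≤ Real.logb 1.1 (A (t j)) := fun j hj =>
    Real.logb_nonneg (by norm_num) (hA1 j hj)
  have hlogW : ∀ j ∈ J, Real.logb 1.1 (A (t j)) ≤ Real.logb 1.1 W := fun j hj =>
    Real.logb_le_logb_of_le (by norm_num) (by linarith [hA1 j hj]) (hAW _)
  obtain ⟨j0, hj0⟩ := hne
  have hW0 : 0 ≤ Real.logb 1.1 W := (hlog0 j0 hj0).trans (hlogW j0 hj0)
  have hcard := Finset.card_le_mul_card_image_of_maps_to (s := J)
    (f := fun j => ⌊Real.logb 1.1 (A (t j))⌋₊)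
    (t := Finset.range (⌊Real.logb 1.1 W⌋₊ + 1))
    (fun j hj => by
      rw [Finset.mem_range]
      exact Nat.lt_succ_of_le (Nat.floor_le_floor (hlogW j hj))) 10 (by
    intro m _
    set F := J.filter (fun j => ⌊Real.logb 1.1 (A (t j))⌋₊ = m) with hF
    rcases F.eq_empty_or_nonempty with h0 | h0
    · rw [h0]; simp
    obtain ⟨j1, hj1, hmin⟩ := F.exists_min_image t h0
    have hFJ : ∀ j ∈ F, j ∈ J := fun j hj => (Finset.mem_filter.1 hj).1
    have hlow : ∀ j ∈ F, (1.1 : ℝ) ^ m ≤ A (t j) := by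
      intro j hj
      have h1 : (m : ℝ) ≤ Real.logb 1.1 (A (t j)) := by
        rw [← (Finset.mem_filter.1 hj).2]
        exact Nat.floor_le (hlog0 j (hFJ j hj))
      rw [Real.le_logb_iff_rpow_le (by norm_num) (by linarith [hA1 j (hFJ j hj)])] at h1
      rwa [Real.rpow_natCast] at h1
    have hup : A (t j1) < (1.1 : ℝ) ^ (m + 1) := by
      have h1 : Real.logb 1.1 (A (t j1)) < ((m + 1 : ℕ) : ℝ) := by
        rw [← (Finset.mem_filter.1 hj1).2]
        push_cast
        exact Nat.lt_floor_add_one _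
      rw [Real.logb_lt_iff_lt_rpow (by norm_num) (by linarith [hA1 j1 (hFJ j1 hj1)])] at h1
      rwa [Real.rpow_natCast] at h1
    have hpos : (0 : ℝ) < 1.1 ^ m := by positivity
    have h2 : (F.card : ℝ) * ((1.1 : ℝ) ^ m / 5) ≤ A (t j1) := by
      calc (F.card : ℝ) * ((1.1 : ℝ) ^ m / 5) = ∑ j ∈ F, (1.1 : ℝ) ^ m / 5 := by
            rw [Finset.sum_const, nsmul_eq_mul]
        _ ≤ ∑ j ∈ F, B (t j1) j := by
            apply Finset.sum_le_sum
            intro j hj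
            have := hlow j hj
            have := hB j (hFJ j hj)
            have := hmono j _ _ (hmin j hj)
            linarith
        _ ≤ ∑ j ∈ J, B (t j1) j :=
            Finset.sum_le_sum_of_subset_of_nonneg (Finset.filter_subset _ _)
              (fun j _ _ => hB0 _ _)
        _ ≤ _ := hsum _
    rw [pow_succ] at hup
    have h3 : (F.card : ℝ) ≤ 10 := by
      by_contra hcon
      push Not at hcon
      nlinarith
    exact_mod_cast h3)
  rw [Finset.card_range] at hcard
  have h4 : (J.card : ℝ) ≤ 10 * ((⌊Real.logb 1.1 W⌋₊ : ℝ) + 1) := by exact_mod_cast hcard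
  have h5 := Nat.floor_le hW0
  linarith

open scoped Classical in
/-- In a star instance with positive integer weights of total weight `W`, each path is
weakly (`1/5`-)interested in at most `10·(2 + log_{1.1} W)` other paths. -/
theorem stmt12 [Fintype V] (G T : SimpleGraph V) (w : Sym2 V → ℤ)
    (hw : ∀ g ∈ G.edgeSet, 1 ≤ w g)
    (hle : T ≤ G) (hT : T.IsTree)
    (r : V) (k : ℕ) (ℓ : Fin k → ℕ) (v : (i : Fin k) → Fin (ℓ i + 1) → V)
    (hv0 : ∀ i, v i 0 = r)
    (hvinj : ∀ i, Function.Injective (v i))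
    (hdisj : ∀ i j x y, i ≠ j → v i x = v j y → v i x = r)
    (hAdj : ∀ x y : V, T.Adj x y ↔
      ∃ (i : Fin k) (t : Fin (ℓ i)), s(x, y) = PathEdge ℓ v i t)
    (i : Fin k) :
    ((Finset.univ.filter (fun j : Fin k => j ≠ i ∧
        ∃ (tP : Fin (ℓ i)) (tQ : Fin (ℓ j)),
          crossCov2 G T (fun g => (w g : ℝ)) ℓ v (PathEdge ℓ v i tP) (PathEdge ℓ v j tQ) >
            crossCov1 G T (fun g => (w g : ℝ)) ℓ v (PathEdge ℓ v i tP) / 5)).card : ℝ)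
      ≤ 10 * (2 + Real.logb 1.1
          (∑ g : Sym2 V, if g ∈ G.edgeSet then (w g : ℝ) else 0)) := by
  set J := Finset.univ.filter (fun j : Fin k => j ≠ i ∧
        ∃ (tP : Fin (ℓ i)) (tQ : Fin (ℓ j)),
          crossCov2 G T (fun g => (w g : ℝ)) ℓ v (PathEdge ℓ v i tP) (PathEdge ℓ v j tQ) >
            crossCov1 G T (fun g => (w g : ℝ)) ℓ v (PathEdge ℓ v i tP) / 5) with hJdef
  have hw0 : ∀ g ∈ G.edgeSet, (0 : ℝ) ≤ w g := by
    intro g hg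
    have := hw g hg
    have h1 : (1 : ℝ) ≤ w g := by exact_mod_cast this
    linarith
  rcases J.eq_empty_or_nonempty with h0 | hne
  · rw [h0]
    have hL : 0 ≤ Real.logb 1.1 (∑ g : Sym2 V, if g ∈ G.edgeSet then (w g : ℝ) else 0) := by
      have hWint : (∑ g : Sym2 V, if g ∈ G.edgeSet then (w g : ℝ) else 0)
          = ((∑ g : Sym2 V, if g ∈ G.edgeSet then w g else 0 : ℤ) : ℝ) := by
        push_cast; rfl
      have hWn : 0 ≤ (∑ g : Sym2 V, if g ∈ G.edgeSet then w g else 0 : ℤ) := by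
        apply Finset.sum_nonneg
        intro g _
        split_ifs with h
        · linarith [hw g h]
        · exact le_rfl
      rw [hWint]
      rcases hWn.eq_or_lt with h | h
      · rw [← h]; simp
      · exact Real.logb_nonneg (by norm_num) (by exact_mod_cast h)
    simp only [Finset.card_empty, Nat.cast_zero]
    linarith
  have hJ : ∀ j : Fin k, j ∈ J → j ≠ i ∧ ∃ (tP : Fin (ℓ i)) (tQ : Fin (ℓ j)),
          crossCov2 G T (fun g => (w g : ℝ)) ℓ v (PathEdge ℓ v i tP) (PathEdge ℓ v j tQ) >
            crossCov1 G T (fun g => (w g : ℝ)) ℓ v (PathEdge ℓ v i tP) / 5 := by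
    intro j hj
    exact (Finset.mem_filter.1 hj).2
  obtain ⟨j0, hj0⟩ := hne
  obtain ⟨_, t0, _⟩ := hJ j0 hj0
  have hex : ∀ j : Fin k, ∃ tP : Fin (ℓ i), j ∈ J → ∃ tQ : Fin (ℓ j),
          crossCov2 G T (fun g => (w g : ℝ)) ℓ v (PathEdge ℓ v i tP) (PathEdge ℓ v j tQ) >
            crossCov1 G T (fun g => (w g : ℝ)) ℓ v (PathEdge ℓ v i tP) / 5 := by
    intro j
    by_cases hj : j ∈ J
    · obtain ⟨_, tP, h⟩ := hJ j hj
      exact ⟨tP, fun _ => h⟩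
    · exact ⟨t0, fun h => absurd h hj⟩
  choose t ht using hex
  let B : Fin (ℓ i) → Fin k → ℝ := fun s j =>
    ∑ g : Sym2 V, if g ∈ G.edgeSet ∧ Joins ℓ v i s j g then (w g : ℝ) else 0
  let A : Fin (ℓ i) → ℝ := fun s => crossCov1 G T (fun g => (w g : ℝ)) ℓ v (PathEdge ℓ v i s)
  have hB0 : ∀ s j, 0 ≤ B s j := by
    intro s j
    apply Finset.sum_nonneg
    intro g _
    split_ifs with h
    · exact hw0 g h.1
    · exact le_rfl
  have hA0 : ∀ s, 0 ≤ A s := by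
    intro s
    apply Finset.sum_nonneg
    intro g _
    split_ifs with h
    · exact hw0 g h.1
    · exact le_rfl
  have hsum : ∀ s, ∑ j ∈ J, B s j ≤ A s := by
    intro s
    show ∑ j ∈ J, ∑ g : Sym2 V, _ ≤ ∑ g : Sym2 V, _
    rw [Finset.sum_comm]
    apply Finset.sum_le_sum
    intro g _
    by_cases hg : g ∈ G.edgeSet ∧ ∃ j ∈ J, Joins ℓ v i s j g
    · obtain ⟨hgG, j, hj, hjg⟩ := hg
      have hc := aux_joins hv0 hvinj hdisj hAdj i s g j (hJ j hj).1 hjg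
      rw [if_pos ⟨hgG, hc⟩, Finset.sum_eq_single j]
      · rw [if_pos ⟨hgG, hjg⟩]
      · intro b hb hbj
        rw [if_neg]
        rintro ⟨_, h⟩
        rcases aux_uniq hv0 hvinj hdisj hjg h with h' | h'
        · exact hbj h'.2.symm
        · exact (hJ j hj).1 h'.2
      · exact fun h => absurd hj h
    · rw [Finset.sum_eq_zero]
      · split_ifs with h
        · exact hw0 g h.1
        · exact le_rfl
      · intro j hj
        rw [if_neg]
        rintro ⟨h1, h2⟩
        exact hg ⟨h1, j, hj, h2⟩
  have hB : ∀ j ∈ J, A (t j) / 5 < B (t j) j := by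
    intro j hj
    obtain ⟨tQ, h⟩ := ht j hj
    refine lt_of_lt_of_le h ?_
    apply Finset.sum_le_sum
    intro g _
    by_cases hc : g ∈ G.edgeSet ∧ IsCrossEdge ℓ v g ∧ EdgeCoversIn T g (PathEdge ℓ v i (t j)) ∧
        EdgeCoversIn T g (PathEdge ℓ v j tQ)
    · obtain ⟨hgG, hcr, h1, h2⟩ := id hc
      obtain ⟨b, hb, hbg⟩ := aux_cov hv0 hvinj hdisj hAdj i (t j) g hcr h1
      obtain ⟨c, hcj, hcg⟩ := aux_cov hv0 hvinj hdisj hAdj j tQ g hcr h2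
      have hbj : b = j := by
        rcases aux_uniq hv0 hvinj hdisj hbg hcg with h' | h'
        · exact absurd h'.1.symm (hJ j hj).1
        · exact h'.2
      subst hbj
      rw [if_pos hc, if_pos ⟨hgG, hbg⟩]
    · rw [if_neg hc]
      split_ifs with h
      · exact hw0 g h.1
      · exact le_rfl
  refine aux_count J t A B _ ?_ ?_ hB hB0 ?_ hsum ⟨j0, hj0⟩
  · intro s
    apply Finset.sum_le_sum
    intro g _
    by_cases h : g ∈ G.edgeSet
    · rw [if_pos h]
      split_ifs
      · exact le_rfl
      · exact hw0 g h
    · rw [if_neg h, if_neg (fun h' => h h'.1)]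
  · intro j hj
    have h1 : B (t j) j ≤ A (t j) :=
      (Finset.single_le_sum (f := fun j' => B (t j) j') (fun j' _ => hB0 _ _) hj).trans (hsum _)
    have h2 := hB j hj
    have h3 := hA0 (t j)
    have h4 : 0 < A (t j) := by linarith
    have hint : A (t j) = ((∑ g : Sym2 V, if g ∈ G.edgeSet ∧ IsCrossEdge ℓ v g ∧
        EdgeCoversIn T g (PathEdge ℓ v i (t j)) then w g else 0 : ℤ) : ℝ) := by
      push_cast; rfl
    rw [hint] at h4 ⊢
    exact_mod_cast h4
  · intro j s s' hss
    apply Finset.sum_le_sum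
    intro g _
    by_cases h : g ∈ G.edgeSet ∧ Joins ℓ v i s' j g
    · have h' : g ∈ G.edgeSet ∧ Joins ℓ v i s j g := by
        obtain ⟨h1, x, y, hx, hr⟩ := h
        exact ⟨h1, x, y, lt_of_le_of_lt (by exact_mod_cast hss) hx, hr⟩
      rw [if_pos h, if_pos h']
    · rw [if_neg h]
      split_ifs with h
      · exact hw0 g h.1
      · exact le_rfl
end
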